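/- arXiv:2404.07535 — 2 statements merged into one kernel-verified Lean document; each statement's English description precedes it below -/
import Mathlib

section
/- Let n ≥ 2 and p = (p', p_n) ∈ ℝ^{n−1}×ℝ with p_n ≠ 0. Then the eigenvalues of the matrix Ā(p) are 1, with multiplicity n−2, together with the two numbers ((1+|p|²) − √((1+|p|²)² − 4p_n²))/(2p_n²) and ((1+|p|²) + √((1+|p|²)² − 4p_n²))/(2p_n²); equivalently, the characteristic polynomial of Ā(p) equals (X−1)^{n−2}(X² − ((1+|p|²)/p_n²)X + 1/p_n²). In particular, (1+|p|²)² − 4p_n² ≥ 0, tr Ā(p) = (n−1) + (1+|p'|²)/p_n² and det Ā(p) = 1/p_n². -/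
noncomputable section
open Set Function

namespace Paper

/-- Euclidean norm of a vector in `Fin n → ℝ`. -/
def enorm {n : ℕ} (v : Fin n → ℝ) : ℝ := Real.sqrt (∑ i, v i ^ 2)

/-- Euclidean ball of center `c` and radius `r`. -/
def ballE {n : ℕ} (c : Fin n → ℝ) (r : ℝ) : Set (Fin n → ℝ) := {x | enorm (x - c) < r}

/-- Open cube `Q_r(x₀) = x₀ + (-r,r)ⁿ`. -/
def Qcube {n : ℕ} (c : Fin n → ℝ) (r : ℝ) : Set (Fin n → ℝ) := {x | ∀ i, |x i - c i| < r}

/-- Spatial partial derivative in the `i`-th direction. -/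
def pd {n : ℕ} (i : Fin n) (f : (Fin n → ℝ) → ℝ) (x : Fin n → ℝ) : ℝ :=
  fderiv ℝ f x (Pi.single i 1)

/-- Spatial gradient. -/
def grad {n : ℕ} (f : (Fin n → ℝ) → ℝ) (x : Fin n → ℝ) : Fin n → ℝ := fun i => pd i f x

/-- Spatial Hessian matrix. -/
def hessian {n : ℕ} (f : (Fin n → ℝ) → ℝ) (x : Fin n → ℝ) : Matrix (Fin n) (Fin n) ℝ :=
  Matrix.of fun i j => pd i (fun y => pd j f y) x

/-- Spatial gradient of a space-time function. -/
def sgrad {n : ℕ} (u : (Fin n → ℝ) × ℝ → ℝ) (p : (Fin n → ℝ) × ℝ) : Fin n → ℝ :=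
  grad (fun y => u (y, p.2)) p.1

/-- Spatial Hessian of a space-time function. -/
def shess {n : ℕ} (u : (Fin n → ℝ) × ℝ → ℝ) (p : (Fin n → ℝ) × ℝ) :
    Matrix (Fin n) (Fin n) ℝ :=
  hessian (fun y => u (y, p.2)) p.1

/-- Time derivative of a space-time function. -/
def tderiv {n : ℕ} (u : (Fin n → ℝ) × ℝ → ℝ) (p : (Fin n → ℝ) × ℝ) : ℝ :=
  deriv (fun s => u (p.1, s)) p.2

/-- Dot product of vectors. -/
def dotv {n : ℕ} (a x : Fin n → ℝ) : ℝ := ∑ i, a i * x i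

/-- The half-cylinder `𝒞_r = (Q_r ∩ {x_ℓ > 0}) × (-r,0]`. -/
def Cset {n : ℕ} (ℓ : Fin n) (r : ℝ) : Set ((Fin n → ℝ) × ℝ) :=
  {p | p.1 ∈ Qcube 0 r ∧ 0 < p.1 ℓ ∧ p.2 ∈ Set.Ioc (-r) 0}

/-- The flat boundary `𝓕_r = (Q_r ∩ {x_ℓ = 0}) × (-r,0]`. -/
def Fset {n : ℕ} (ℓ : Fin n) (r : ℝ) : Set ((Fin n → ℝ) × ℝ) :=
  {p | p.1 ∈ Qcube 0 r ∧ p.1 ℓ = 0 ∧ p.2 ∈ Set.Ioc (-r) 0}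

/-- The set `𝓡_K = {p : |p| ≤ K, p_ℓ ≥ K⁻¹}`. -/
def RK {n : ℕ} (ℓ : Fin n) (K : ℝ) : Set (Fin n → ℝ) := {p | enorm p ≤ K ∧ K⁻¹ ≤ p ℓ}

/-- Parabolic distance. -/
def parDist {n : ℕ} (p q : (Fin n → ℝ) × ℝ) : ℝ :=
  Real.sqrt (enorm (p.1 - q.1) ^ 2 + |p.2 - q.2|)

/-- The time dependent affine function `ℓ_{a,b}(x,t) = a(t)·x + b(t)`. -/
def ellF {n : ℕ} (a : ℝ → Fin n → ℝ) (b : ℝ → ℝ) (p : (Fin n → ℝ) × ℝ) : ℝ :=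
  dotv (a p.2) p.1 + b p.2

/-- The boundary function `g(p) = -(1+|p'|²)/p_ℓ`. -/
def gfun {n : ℕ} (ℓ : Fin n) (p : Fin n → ℝ) : ℝ :=
  -(1 + ∑ i ∈ Finset.univ.erase ℓ, p i ^ 2) / p ℓ

/-- The gradient `∇g` of the boundary function `g`. -/
def gradg {n : ℕ} (ℓ : Fin n) (p : Fin n → ℝ) : Fin n → ℝ := fun i =>
  if i = ℓ then (1 + ∑ k ∈ Finset.univ.erase ℓ, p k ^ 2) / p ℓ ^ 2 else -(2 * p i) / p ℓ

/-- The coefficient matrix `Ā(p)` arising from the hodograph transform. -/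
def Abar {n : ℕ} (ℓ : Fin n) (p : Fin n → ℝ) : Matrix (Fin n) (Fin n) ℝ :=
  Matrix.of fun i j =>
    if i = ℓ then
      (if j = ℓ then (1 + ∑ k ∈ Finset.univ.erase ℓ, p k ^ 2) / p ℓ ^ 2 else -(p j) / p ℓ)
    else if j = ℓ then -(p i) / p ℓ
    else if i = j then 1 else 0

/-- Symmetric matrices with ellipticity constants `K⁻¹` and `K` (Loewner order). -/
def Elliptic {n : ℕ} (K : ℝ) (A : Matrix (Fin n) (Fin n) ℝ) : Prop :=
  A.IsSymm ∧ (A - K⁻¹ • (1 : Matrix (Fin n) (Fin n) ℝ)).PosSemidef ∧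
    (K • (1 : Matrix (Fin n) (Fin n) ℝ) - A).PosSemidef

/-- Pucci maximal operator `𝓜⁺_K`. -/
def puPlus {n : ℕ} (K : ℝ) (N : Matrix (Fin n) (Fin n) ℝ) : ℝ :=
  sSup ((fun A => (A * N).trace) '' {A | Elliptic K A})

/-- Pucci minimal operator `𝓜⁻_K`. -/
def puMinus {n : ℕ} (K : ℝ) (N : Matrix (Fin n) (Fin n) ℝ) : ℝ :=
  sInf ((fun A => (A * N).trace) '' {A | Elliptic K A})

/-- Cubical parabolic cylinder `Q_r(x₀) × (t₀ - r², t₀]`. -/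
def cylQ {n : ℕ} (x₀ : Fin n → ℝ) (t₀ r : ℝ) : Set ((Fin n → ℝ) × ℝ) :=
  Qcube x₀ r ×ˢ Set.Ioc (t₀ - r ^ 2) t₀

/-- Round parabolic cylinder `B_r(x₀) × (t₀ - r², t₀]`. -/
def pcyl {n : ℕ} (x₀ : Fin n → ℝ) (t₀ r : ℝ) : Set ((Fin n → ℝ) × ℝ) :=
  ballE x₀ r ×ˢ Set.Ioc (t₀ - r ^ 2) t₀

/-- The distance `d_λ` interpolating between parabolic and Euclidean distances. -/
def dLam {n : ℕ} (ℓ : Fin n) (lam : ℝ) (p q : (Fin n → ℝ) × ℝ) : ℝ :=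
  min (Real.sqrt (∑ i ∈ Finset.univ.erase ℓ, (p.1 i - q.1 i) ^ 2) + |p.1 ℓ - q.1 ℓ| +
        Real.sqrt (|p.2 - q.2| / lam))
      (Real.sqrt (∑ i ∈ Finset.univ.erase ℓ, (p.1 i - q.1 i) ^ 2) + |p.1 ℓ| + |q.1 ℓ| +
        |p.2 - q.2|)

open Classical in
/-- The balls `𝓑_{λ,r}(x₀,t₀)` induced by the metric `d_λ`. -/
def Bball {n : ℕ} (ℓ : Fin n) (lam r : ℝ) (x₀ : Fin n → ℝ) (t₀ : ℝ) :
    Set ((Fin n → ℝ) × ℝ) :=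
  if r < |x₀ ℓ| then Qcube x₀ r ×ˢ Set.Ioc (t₀ - lam * r ^ 2) t₀
  else (Qcube x₀ r ∩ {x | 0 ≤ x ℓ}) ×ˢ Set.Ioc (t₀ - r) t₀

/-- Graph of a multi-valued function over a domain `D`. -/
def MVgraph {n : ℕ} (D : Set ((Fin n → ℝ) × ℝ)) (u : (Fin n → ℝ) × ℝ → Set ℝ) :
    Set (((Fin n → ℝ) × ℝ) × ℝ) := {q | q.1 ∈ D ∧ q.2 ∈ u q.1}

end Paper
namespace Paper

open Polynomial Matrix in
/-- Characteristic polynomial of the symmetric matrix whose only nonzero row and column are the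
`l`-th ones, with diagonal entry `c` and off-diagonal entries `w`. -/
theorem charpoly_vecMulVec_single_add {m : ℕ} (l : Fin (m + 2)) (c : ℝ) (w : Fin (m + 2) → ℝ)
    (hw : w l = 0) :
    (vecMulVec (Pi.single l 1) (w + Pi.single l c) + vecMulVec w (Pi.single l 1)).charpoly =
      X ^ m * (X ^ 2 - C c * X - C (∑ i, w i ^ 2)) := by
  let U : Matrix (Fin (m + 2)) (Fin 2) ℝ := (Matrix.of ![Pi.single l 1, w])ᵀ
  let V : Matrix (Fin 2) (Fin (m + 2)) ℝ := Matrix.of ![w + Pi.single l c, Pi.single l 1]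
  have hUV : vecMulVec (Pi.single l 1) (w + Pi.single l c) + vecMulVec w (Pi.single l 1) =
      U * V := by
    ext i j
    simp [U, V, Matrix.mul_apply, Fin.sum_univ_two, vecMulVec_apply]
  have h00 : (V * U) 0 0 = c := by
    simp [U, V, Matrix.mul_apply, Pi.single_apply, hw]
  have h01 : (V * U) 0 1 = ∑ i, w i ^ 2 := by
    simp [U, V, Matrix.mul_apply, Pi.single_apply, hw, add_mul, Finset.sum_add_distrib, sq]
  have h10 : (V * U) 1 0 = 1 := by
    simp [U, V, Matrix.mul_apply, Pi.single_apply]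
  have h11 : (V * U) 1 1 = 0 := by
    simp [U, V, Matrix.mul_apply, Pi.single_apply, hw]
  rw [hUV, charpoly_mul_comm_of_le _ _ (by simp), charpoly_fin_two, trace_fin_two, det_fin_two,
    h00, h01, h10, h11]
  simp [sub_eq_add_neg]

open Polynomial Matrix in
theorem charpoly_Abar {m : ℕ} (l : Fin (m + 2)) (p : Fin (m + 2) → ℝ) (hp : p l ≠ 0) :
    (Abar l p).charpoly =
      (X - 1) ^ m *
        (X ^ 2 - C ((1 + ∑ i, p i ^ 2) / p l ^ 2) * X + C ((p l ^ 2)⁻¹)) := by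
  let w : Fin (m + 2) → ℝ := fun i => if i = l then 0 else -(p i) / p l
  let c : ℝ := (1 + ∑ k ∈ Finset.univ.erase l, p k ^ 2) / p l ^ 2 - 1
  have hA : Abar l p - scalar (Fin (m + 2)) 1 =
      vecMulVec (Pi.single l 1) (w + Pi.single l c) + vecMulVec w (Pi.single l 1) := by
    ext i j
    by_cases hi : i = l <;> by_cases hj : j = l <;> by_cases hij : i = j <;>
      simp_all [Abar, w, c, vecMulVec_apply]
  have hw : ∑ i, w i ^ 2 = (∑ k ∈ Finset.univ.erase l, p k ^ 2) / p l ^ 2 := by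
    rw [← Finset.add_sum_erase _ _ (Finset.mem_univ l), Finset.sum_div]
    simp only [w, if_true, ne_eq, OfNat.ofNat_ne_zero, not_false_eq_true, zero_pow, zero_add]
    refine Finset.sum_congr rfl fun k hk => ?_
    rw [if_neg (Finset.ne_of_mem_erase hk), div_pow, neg_sq]
  have hS : ∑ i, p i ^ 2 = p l ^ 2 + ∑ k ∈ Finset.univ.erase l, p k ^ 2 :=
    (Finset.add_sum_erase _ _ (Finset.mem_univ l)).symm
  have hshift := charpoly_sub_scalar (Abar l p) 1
  rw [hA, charpoly_vecMulVec_single_add l c w (by simp [w]), hw] at hshift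
  have hcomp := congrArg (fun f : ℝ[X] => f.comp (X - C 1)) hshift
  simp only [Polynomial.comp_assoc, add_comp, sub_comp, mul_comp, pow_comp, X_comp, C_comp,
    sub_add_cancel, comp_X] at hcomp
  rw [← hcomp, hS]
  simp only [c]
  generalize ∑ k ∈ Finset.univ.erase l, p k ^ 2 = S
  have h1 : (1 + (p l ^ 2 + S)) / p l ^ 2 = (1 + S) / p l ^ 2 + 1 := by
    field_simp; ring
  have h2 : (p l ^ 2)⁻¹ = (1 + S) / p l ^ 2 - S / p l ^ 2 := by
    field_simp; ring
  rw [h1, h2]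
  simp only [C_add, C_sub, C_1]
  ring

theorem four_mul_sq_le_one_add_sum_sq_sq {ι : Type*} [Fintype ι] (l : ι) (p : ι → ℝ) :
    4 * p l ^ 2 ≤ (1 + ∑ i, p i ^ 2) ^ 2 := by
  have h : p l ^ 2 ≤ ∑ i, p i ^ 2 :=
    Finset.single_le_sum (f := fun i => p i ^ 2) (fun i _ => sq_nonneg _) (Finset.mem_univ l)
  nlinarith [sq_nonneg (1 - p l ^ 2), sq_nonneg (p l)]

theorem trace_Abar {m : ℕ} (l : Fin (m + 1)) (p : Fin (m + 1) → ℝ) :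
    (Abar l p).trace =
      (m : ℝ) + (1 + ∑ i ∈ Finset.univ.erase l, p i ^ 2) / p l ^ 2 := by
  rw [Matrix.trace, ← Finset.add_sum_erase _ _ (Finset.mem_univ l),
    Finset.sum_congr rfl (g := fun _ => (1 : ℝ))
      fun k hk => by simp [Abar, Finset.ne_of_mem_erase hk]]
  simp [Abar, add_comm]

/-- A root of the quadratic factor, with `s` either square root of the discriminant. -/
theorem quadratic_eq_zero_of_sq_eq_discrim {T q s : ℝ} (hq : q ≠ 0) (hs : s ^ 2 = T ^ 2 - 4 * q ^ 2) :
    ((T + s) / (2 * q ^ 2)) ^ 2 - T / q ^ 2 * ((T + s) / (2 * q ^ 2)) + (q ^ 2)⁻¹ = 0 := by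
  field_simp
  linear_combination hs

open Polynomial in
/-- Eigenvalues of the matrix `Ā(p)`: the characteristic polynomial is
`(X-1)^{n-2}(X² - ((1+|p|²)/p_ℓ²)X + 1/p_ℓ²)`, whose quadratic factor has the two roots
`((1+|p|²) ∓ √((1+|p|²)² - 4p_ℓ²))/(2p_ℓ²)`; in particular the discriminant
`(1+|p|²)² - 4p_ℓ²` is nonnegative, `tr Ā(p) = (n-1) + (1+|p'|²)/p_ℓ²` and
`det Ā(p) = 1/p_ℓ²`.  The dimension is `n = m + 2 ≥ 2` and `ℓ` the last coordinate. -/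
theorem Abar_eigenvalues (m : ℕ) (p : Fin (m + 2) → ℝ)
    (hp : p (Fin.last (m + 1)) ≠ 0) :
    (Abar (Fin.last (m + 1)) p).charpoly =
      (X - 1) ^ m *
        (X ^ 2 - C ((1 + ∑ i, p i ^ 2) / p (Fin.last (m + 1)) ^ 2) * X +
          C ((p (Fin.last (m + 1)) ^ 2)⁻¹)) ∧
    0 ≤ (1 + ∑ i, p i ^ 2) ^ 2 - 4 * p (Fin.last (m + 1)) ^ 2 ∧
    (Abar (Fin.last (m + 1)) p).trace =
      (m + 1 : ℝ) + (1 + ∑ i ∈ Finset.univ.erase (Fin.last (m + 1)), p i ^ 2) /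
        p (Fin.last (m + 1)) ^ 2 ∧
    (Abar (Fin.last (m + 1)) p).det = (p (Fin.last (m + 1)) ^ 2)⁻¹ ∧
    (Abar (Fin.last (m + 1)) p).charpoly.IsRoot
      (((1 + ∑ i, p i ^ 2) -
          Real.sqrt ((1 + ∑ i, p i ^ 2) ^ 2 - 4 * p (Fin.last (m + 1)) ^ 2)) /
        (2 * p (Fin.last (m + 1)) ^ 2)) ∧
    (Abar (Fin.last (m + 1)) p).charpoly.IsRoot
      (((1 + ∑ i, p i ^ 2) +
          Real.sqrt ((1 + ∑ i, p i ^ 2) ^ 2 - 4 * p (Fin.last (m + 1)) ^ 2)) /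
        (2 * p (Fin.last (m + 1)) ^ 2)) ∧
    (1 ≤ m → (Abar (Fin.last (m + 1)) p).charpoly.IsRoot 1) := by
  have hchar := charpoly_Abar (Fin.last (m + 1)) p hp
  have hD := four_mul_sq_le_one_add_sum_sq_sq (Fin.last (m + 1)) p
  have hsq := Real.sq_sqrt (sub_nonneg.mpr hD)
  refine ⟨hchar, sub_nonneg.mpr hD, ?_, ?_, ?_, ?_, fun hm => ?_⟩
  · exact_mod_cast trace_Abar (Fin.last (m + 1)) p
  · rw [Matrix.det_eq_sign_charpoly_coeff, hchar, coeff_zero_eq_eval_zero]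
    simp [pow_add, ← mul_assoc, ← mul_pow]
  · have h := quadratic_eq_zero_of_sq_eq_discrim hp ((neg_sq _).trans hsq)
    rw [← sub_eq_add_neg] at h
    rw [hchar, IsRoot.def, eval_mul]
    simp only [eval_add, eval_sub, eval_mul, eval_pow, eval_X, eval_C, h, mul_zero]
  · have h := quadratic_eq_zero_of_sq_eq_discrim hp hsq
    rw [hchar, IsRoot.def, eval_mul]
    simp only [eval_add, eval_sub, eval_mul, eval_pow, eval_X, eval_C, h, mul_zero]
  · rw [hchar, IsRoot.def, eval_mul]
    simp [Nat.one_le_iff_ne_zero.mp hm]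

end Paper
end
end

section
/- Let K ≥ 1, a_n ∈ [K⁻¹, K], b ∈ ℝ, λ, ε₁ > 0, and constants C₀ > 2C₁ > 0. Let x₀ ∈ ℝⁿ and u : ℝⁿ → ℝ satisfy |u(x) − a_n(x_n − b)⁺| ≤ C₁ε₁λ for all x ∈ Q_λ(x₀), and u(x₀) ≥ C₀ε₁λ. Then every point x̄ with u(x̄) = 0 satisfies ‖x₀ − x̄‖_∞ ≥ min{λ, (C₀ − 2C₁)ε₁λ/a_n}; in particular the distance (in the sup norm) from x₀ to the zero set of u is at least min{λ, (C₀ − 2C₁)ε₁λ/a_n}. -/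
noncomputable section
open Set Function

namespace Paper

/-- Lower bound on the distance from a point of sufficient positivity to the zero set
(from Remark 3.1): if `|u - a_n(x_n - b)⁺| ≤ C₁ε₁λ` in `Q_λ(x₀)` and
`u(x₀) ≥ C₀ε₁λ` with `C₀ > 2C₁`, then every zero `x̄` of `u` satisfies
`‖x₀ - x̄‖_∞ ≥ min{λ, (C₀ - 2C₁)ε₁λ/a_n}`.  The dimension is `n = m + 2 ≥ 2`. -/
theorem distance_to_zero_set (m : ℕ) (K aN b lam ε₁ C₀ C₁ : ℝ)
    (x₀ : Fin (m + 2) → ℝ) (u : (Fin (m + 2) → ℝ) → ℝ)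
    (hK : 1 ≤ K) (haN : aN ∈ Icc K⁻¹ K) (hlam : 0 < lam) (hε : 0 < ε₁)
    (hC₁ : 0 < C₁) (hC₀ : 2 * C₁ < C₀)
    (hu : ∀ x ∈ Qcube x₀ lam, |u x - aN * max (x (Fin.last (m + 1)) - b) 0| ≤ C₁ * ε₁ * lam)
    (hx₀ : C₀ * ε₁ * lam ≤ u x₀) :
    ∀ x : Fin (m + 2) → ℝ, u x = 0 →
      min lam ((C₀ - 2 * C₁) * ε₁ * lam / aN) ≤ ‖x₀ - x‖ := by
  intro x hx
  have ha : 0 < aN := (inv_pos.mpr (by linarith)).trans_le haN.1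
  by_contra! h
  obtain ⟨hlt, hlt'⟩ := lt_min_iff.mp h
  have hcoord (i : Fin (m + 2)) : |x₀ i - x i| ≤ ‖x₀ - x‖ := norm_le_pi_norm (x₀ - x) i
  have h₀ := (abs_le.mp (hu x₀ fun i => by simpa using hlam)).2
  have h₁ := (abs_le.mp (hu x fun i => by
    rw [abs_sub_comm]; exact (hcoord i).trans_lt hlt)).1
  rw [lt_div_iff₀ ha] at hlt'
  have hmax : max (x₀ (Fin.last (m + 1)) - b) 0 - max (x (Fin.last (m + 1)) - b) 0
      ≤ ‖x₀ - x‖ := by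
    have hmm := abs_max_sub_max_le_abs (x₀ (Fin.last (m + 1)) - b) (x (Fin.last (m + 1)) - b) 0
    rw [sub_sub_sub_cancel_right] at hmm
    exact (le_abs_self _).trans (hmm.trans (hcoord _))
  have hmul := mul_le_mul_of_nonneg_left hmax ha.le
  rw [mul_sub] at hmul
  linarith

end Paper
end
end
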